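/- In the braid group B_N the mixed relation M2 holds: for all 2 ≤ i < j ≤ N, σ_{i−1}⁻¹ a_{ij} σ_{i−1} = a_{i−1,j}. -/

import Mathlib

open FreeGroup

namespace BraidPaper

/-- Relators for the Artin braid group on generators `σ_1, …, σ_n`
(so this presents the braid group `B_{n+1}`); the generator with index `k : Fin n`
represents `σ_{k+1}`. -/
def braidRels (n : ℕ) : Set (FreeGroup (Fin n)) :=
  {x | ∃ k l : Fin n, ((k : ℕ) + 2 ≤ (l : ℕ) ∨ (l : ℕ) + 2 ≤ (k : ℕ)) ∧
      x = of k * of l * (of k)⁻¹ * (of l)⁻¹} ∪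
  {x | ∃ k l : Fin n, (l : ℕ) = (k : ℕ) + 1 ∧
      x = of k * of l * of k * (of l)⁻¹ * (of k)⁻¹ * (of l)⁻¹}

/-- The braid group with `n` generators `σ_1, …, σ_n`, i.e. the Artin braid group
`B_{n+1}`.  Thus `B_N = BraidGroup (N-1)`. -/
abbrev BraidGroup (n : ℕ) : Type := PresentedGroup (braidRels n)

/-- The generator `σ_k` (1-based) of `BraidGroup n`, for `1 ≤ k ≤ n`. -/
def sgen (n k : ℕ) : BraidGroup n :=
  if h : 1 ≤ k ∧ k ≤ n then PresentedGroup.of ⟨k - 1, by omega⟩ else 1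

/-- The descending product `σ_{j-1} σ_{j-2} ⋯ σ_{i+1}`. -/
def dprod (n i j : ℕ) : BraidGroup n :=
  ((List.range (j - 1 - i)).map fun t => sgen n (j - 1 - t)).prod

/-- The pure braid generator
`a_{ij} = σ_{j-1} σ_{j-2} ⋯ σ_{i+1} σ_i² σ_{i+1}⁻¹ ⋯ σ_{j-2}⁻¹ σ_{j-1}⁻¹`. -/
def agen (n i j : ℕ) : BraidGroup n := dprod n i j * (sgen n i) ^ 2 * (dprod n i j)⁻¹
theorem sgen_commute {n k l : ℕ} (h : k + 2 ≤ l) : Commute (sgen n k) (sgen n l) := by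
  unfold sgen
  split_ifs with hk hl
  · have key : PresentedGroup.mk (braidRels n) _ = 1 :=
      PresentedGroup.one_of_mem (Or.inl ⟨⟨k - 1, by omega⟩, ⟨l - 1, by omega⟩,
        Or.inl (by change k - 1 + 2 ≤ l - 1; omega), rfl⟩)
    simp only [_root_.map_mul, _root_.map_inv, mul_inv_eq_iff_eq_mul, one_mul] at key
    exact key
  all_goals simp

theorem sgen_braid {n k : ℕ} (hk : 1 ≤ k) (hn : k + 1 ≤ n) :
    sgen n k * sgen n (k + 1) * sgen n k = sgen n (k + 1) * sgen n k * sgen n (k + 1) := by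
  have key : PresentedGroup.mk (braidRels n) _ = 1 :=
    PresentedGroup.one_of_mem (Or.inr ⟨⟨k - 1, by omega⟩, ⟨k + 1 - 1, by omega⟩,
      by change k + 1 - 1 = k - 1 + 1; omega, rfl⟩)
  simp only [_root_.map_mul, _root_.map_inv, mul_inv_eq_iff_eq_mul, one_mul] at key
  rw [sgen, dif_pos ⟨hk, by omega⟩, sgen, dif_pos ⟨by omega, hn⟩]
  exact key

theorem sgen_commute_dprod {n k i : ℕ} (j : ℕ) (h : k < i) :
    Commute (sgen n k) (dprod n i j) := by
  refine Commute.list_prod_right _ _ fun x hx => ?_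
  obtain ⟨t, ht, rfl⟩ := List.mem_map.mp hx
  exact sgen_commute (by have := List.mem_range.mp ht; omega)

theorem dprod_eq_dprod_succ_mul (n : ℕ) {i j : ℕ} (h : i + 1 < j) :
    dprod n i j = dprod n (i + 1) j * sgen n (i + 1) := by
  have hlen : j - 1 - i = j - 1 - (i + 1) + 1 := by omega
  have hlast : j - 1 - (j - 1 - (i + 1)) = i + 1 := by omega
  rw [dprod, hlen, List.range_succ]
  simp [dprod, hlast]

theorem inv_mul_sq_mul_of_braid {G : Type*} [Group G] {a b : G} (h : a * b * a = b * a * b) :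
    a⁻¹ * b ^ 2 * a = b * a ^ 2 * b⁻¹ := by
  have hconj : a⁻¹ * b * a = b * a * b⁻¹ := by
    rw [eq_mul_inv_iff_mul_eq, mul_assoc, mul_assoc, inv_mul_eq_iff_eq_mul]
    simpa only [mul_assoc] using h.symm
  calc a⁻¹ * b ^ 2 * a = (a⁻¹ * b * a) ^ 2 := by simp only [sq]; group
    _ = b * a ^ 2 * b⁻¹ := by rw [hconj, conj_pow]

/-- Mixed relation M2: `σ_{i−1}⁻¹ a_{ij} σ_{i−1} = a_{i−1,j}` for `2 ≤ i < j ≤ N`. -/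
theorem statement6 (N : ℕ) (hN : 2 ≤ N) (i j : ℕ)
    (hi : 2 ≤ i) (hij : i < j) (hj : j ≤ N) :
    (sgen (N - 1) (i - 1))⁻¹ * agen (N - 1) i j * sgen (N - 1) (i - 1) =
      agen (N - 1) (i - 1) j := by
  obtain ⟨k, rfl⟩ : ∃ k, i = k + 1 := ⟨i - 1, by omega⟩
  rw [Nat.add_sub_cancel, agen, agen, dprod_eq_dprod_succ_mul (N - 1) hij]
  have hcomm : Commute (sgen (N - 1) k) (dprod (N - 1) (k + 1) j) :=
    sgen_commute_dprod j k.lt_succ_self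
  have hsq := inv_mul_sq_mul_of_braid (sgen_braid (n := N - 1) (k := k) (by omega) (by omega))
  generalize dprod (N - 1) (k + 1) j = d at *
  generalize sgen (N - 1) k = a at *
  generalize sgen (N - 1) (k + 1) = b at *
  calc a⁻¹ * (d * b ^ 2 * d⁻¹) * a = (a⁻¹ * d) * b ^ 2 * (d⁻¹ * a) := by group
    _ = (d * a⁻¹) * b ^ 2 * (a * d⁻¹) := by
      rw [hcomm.inv_left.eq, hcomm.inv_right.eq]
    _ = d * (a⁻¹ * b ^ 2 * a) * d⁻¹ := by group
    _ = d * b * a ^ 2 * (d * b)⁻¹ := by rw [hsq]; group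

end BraidPaper
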